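/- Let X = S¹ be the circle, G = Homeo(S¹) the group of all homeomorphisms of S¹ acting on X in the natural way, and σ : G → Aut(C(X)) the induced homomorphism σ_g(f)(x) = f(g^{-1}(x)). Then C(X) is not a maximal commutative subalgebra of the skew group algebra C(X) ⋊_σ G, and consequently C(X) ⋊_σ G is not a simple ring (even though the action is faithful and minimal, σ is injective, C(X) is G-simple, and Z(C(X) ⋊_σ G) is a field). -/

import Mathlib

/-- `R`, together with a ring embedding `ι : A →+* R` and a family `u : G → R` of
distinguished elements, is a skew group ring `A ⋊_σ G`: the `u g` satisfy
`u 1 = 1`, `u g * u h = u (g * h)`, the twisted commutation rule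
`u g * ι a = ι (σ g a) * u g` (which forces `(a u_g)(b u_h) = a σ_g(b) u_{gh}`),
and `R` is a free left `A`-module with basis `{u g}_{g ∈ G}`, i.e. every element
of `R` is uniquely a finite sum `∑ a_g u_g`. -/
def IsSkewGroupRing {A G R : Type*} [Ring A] [Group G] [Ring R]
    (σ : G →* RingAut A) (ι : A →+* R) (u : G → R) : Prop :=
  u 1 = 1 ∧
  (∀ g h : G, u g * u h = u (g * h)) ∧
  (∀ (g : G) (a : A), u g * ι a = ι (σ g a) * u g) ∧
  (∀ r : R, ∃! f : G →₀ A, r = f.sum fun g a => ι a * u g)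

/-- `A` is `G`-simple: the only `G`-invariant (two-sided) ideals of `A` are `{0}` and `A`. -/
def IsGSimple {A G : Type*} [Ring A] [Group G] (σ : G →* RingAut A) : Prop :=
  ∀ I : TwoSidedIdeal A, (∀ (g : G) (a : A), a ∈ I → σ g a ∈ I) → I = ⊥ ∨ I = ⊤

/-- The group of self-homeomorphisms of a topological space, under composition
(`(g * h) x = g (h x)`). -/
instance homeoGroup (X : Type*) [TopologicalSpace X] : Group (X ≃ₜ X) where
  mul g h := h.trans g
  one := Homeomorph.refl X
  inv := Homeomorph.symm
  mul_assoc _ _ _ := Homeomorph.ext fun _ => rfl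
  one_mul _ := Homeomorph.ext fun _ => rfl
  mul_one _ := Homeomorph.ext fun _ => rfl
  inv_mul_cancel g := Homeomorph.ext g.symm_apply_apply

namespace IsSkewGroupRing

variable {A G R : Type*} [Group G] [Ring R]

section Ring

variable [Ring A] {σ : G →* RingAut A} {ι : A →+* R} {u : G → R}

/-- The additive isomorphism sending a finitely supported family `(a_g)` to `∑ a_g u_g`. -/
noncomputable def sumEquiv (h : IsSkewGroupRing σ ι u) : (G →₀ A) ≃+ R :=
  AddEquiv.ofBijective
    (Finsupp.liftAddHom fun g => (AddMonoidHom.mulRight (u g)).comp ι.toAddMonoidHom) <| by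
    refine ⟨fun f f' hf => ?_, fun r => ?_⟩
    · exact (h.2.2.2 _).unique rfl hf
    · obtain ⟨f, hf, -⟩ := h.2.2.2 r
      exact ⟨f, hf.symm⟩

theorem sumEquiv_single (h : IsSkewGroupRing σ ι u) (g : G) (a : A) :
    h.sumEquiv (Finsupp.single g a) = ι a * u g := by
  simp [sumEquiv]

theorem sumEquiv_symm_mul (h : IsSkewGroupRing σ ι u) (g : G) (a : A) :
    h.sumEquiv.symm (ι a * u g) = Finsupp.single g a := by
  rw [← h.sumEquiv_single, AddEquiv.symm_apply_apply]

theorem sumEquiv_symm_embed (h : IsSkewGroupRing σ ι u) (a : A) :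
    h.sumEquiv.symm (ι a) = Finsupp.single 1 a := by
  rw [← h.sumEquiv_symm_mul, h.1, mul_one]

theorem induction_on (h : IsSkewGroupRing σ ι u) {p : R → Prop} (r : R)
    (zero : p 0) (add : ∀ x y, p x → p y → p (x + y)) (monomial : ∀ a g, p (ι a * u g)) : p r := by
  obtain ⟨f, rfl⟩ := h.sumEquiv.surjective r
  induction f using Finsupp.induction_linear with
  | zero => simpa using zero
  | add f f' hf hf' => simpa using add _ _ hf hf'
  | single g a => simpa [h.sumEquiv_single] using monomial a g

theorem monomial_mul_monomial (h : IsSkewGroupRing σ ι u) (a b : A) (g k : G) :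
    ι a * u g * (ι b * u k) = ι (a * σ g b) * u (g * k) := by
  rw [mul_assoc, ← mul_assoc (u g), h.2.2.1, map_mul, ← h.2.1]
  simp only [mul_assoc]

/-- The augmentation `∑ a_g u_g ↦ ∑ a_g`. -/
noncomputable def augmentation (h : IsSkewGroupRing σ ι u) : R →+ A :=
  (Finsupp.liftAddHom fun _ => AddMonoidHom.id A).comp h.sumEquiv.symm.toAddMonoidHom

theorem augmentation_monomial (h : IsSkewGroupRing σ ι u) (a : A) (g : G) :
    h.augmentation (ι a * u g) = a := by
  simp [augmentation, h.sumEquiv_symm_mul]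

theorem augmentation_one (h : IsSkewGroupRing σ ι u) : h.augmentation 1 = 1 := by
  simpa [h.1] using h.augmentation_monomial 1 1

theorem augmentation_monomial_mul (h : IsSkewGroupRing σ ι u) (a : A) (g : G) (r : R) :
    h.augmentation (ι a * u g * r) = a * σ g (h.augmentation r) := by
  induction r using h.induction_on with
  | zero => simp
  | add x y hx hy => simp [mul_add, hx, hy]
  | monomial b k => rw [h.monomial_mul_monomial, h.augmentation_monomial, h.augmentation_monomial]

theorem augmentation_mul_eq_zero (h : IsSkewGroupRing σ ι u) (s : R) {r : R}
    (hr : h.augmentation r = 0) : h.augmentation (s * r) = 0 := by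
  induction s using h.induction_on with
  | zero => simp
  | add x y hx hy => simp [add_mul, hx, hy]
  | monomial b k => simp [h.augmentation_monomial_mul, hr]

/-- The annihilator of the left module `A ≅ R / ker augmentation`. -/
noncomputable def augmentationAnnihilator (h : IsSkewGroupRing σ ι u) : TwoSidedIdeal R :=
  .mk' {r | ∀ s, h.augmentation (r * s) = 0}
    (by simp)
    (fun hx hy s => by simp [add_mul, hx s, hy s])
    (fun hx s => by simp [hx s])
    (fun {x y} hy s => by rw [mul_assoc]; exact h.augmentation_mul_eq_zero x (hy s))
    (fun {x y} hx s => by rw [mul_assoc]; exact hx (y * s))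

theorem mem_augmentationAnnihilator (h : IsSkewGroupRing σ ι u) {r : R} :
    r ∈ h.augmentationAnnihilator ↔ ∀ s, h.augmentation (r * s) = 0 := by
  simp [augmentationAnnihilator]

/-- If `f σ_g(b) = f b` for all `b`, with `f ≠ 0` and `g ≠ 1`, then the skew group ring has
a nontrivial two-sided ideal. -/
theorem not_isSimpleRing (h : IsSkewGroupRing σ ι u) {f : A} {g : G} (hf : f ≠ 0)
    (hg : g ≠ 1) (hfg : ∀ b, f * σ g b = f * b) : ¬ IsSimpleRing R := by
  intro _
  rcases eq_bot_or_eq_top h.augmentationAnnihilator with hI | hI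
  · have hmem : ι f * u g - ι f * u 1 ∈ h.augmentationAnnihilator := by
      rw [h.mem_augmentationAnnihilator]
      intro s
      rw [sub_mul, map_sub, h.augmentation_monomial_mul, h.augmentation_monomial_mul, hfg]
      simp
    rw [hI, TwoSidedIdeal.mem_bot, sub_eq_zero, ← h.sumEquiv_single, ← h.sumEquiv_single,
      h.sumEquiv.injective.eq_iff, Finsupp.single_left_inj hf] at hmem
    exact hg hmem
  · have hone : (1 : R) ∈ h.augmentationAnnihilator := hI ▸ trivial
    have := h.mem_augmentationAnnihilator.1 hone 1
    rw [one_mul, h.augmentation_one] at this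
    exact hf (by rw [← mul_one f, this, mul_zero])

end Ring

theorem centralizer_ne_range [CommRing A] {σ : G →* RingAut A} {ι : A →+* R} {u : G → R}
    (h : IsSkewGroupRing σ ι u) {f : A} {g : G} (hf : f ≠ 0)
    (hg : g ≠ 1) (hfg : ∀ b, f * σ g b = f * b) :
    Subring.centralizer (Set.range ι) ≠ ι.range := by
  intro heq
  have hmem : ι f * u g ∈ Subring.centralizer (Set.range ι) := by
    rw [Subring.mem_centralizer_iff]
    rintro _ ⟨b, rfl⟩
    rw [mul_assoc, h.2.2.1, ← mul_assoc, ← mul_assoc, ← map_mul, ← map_mul, hfg, mul_comm]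
  rw [heq] at hmem
  obtain ⟨a, ha⟩ := hmem
  have := congrArg h.sumEquiv.symm ha
  rw [h.sumEquiv_symm_mul, h.sumEquiv_symm_embed, Finsupp.single_eq_single_iff] at this
  rcases this with ⟨h1, -⟩ | ⟨-, h0⟩
  · exact hg h1.symm
  · exact hf h0

end IsSkewGroupRing

namespace Circle

/-- The piecewise linear shear of the plane that is the identity on the upper half plane. -/
noncomputable def shear (s : ℝ) (z : ℂ) : ℂ := z + (s * min z.im 0 : ℝ)

theorem shear_im (s : ℝ) (z : ℂ) : (shear s z).im = z.im := by
  simp [shear]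

theorem shear_neg_shear (s : ℝ) (z : ℂ) : shear (-s) (shear s z) = z := by
  rw [shear, shear_im, shear]
  push_cast
  ring

theorem shear_real_mul (s : ℝ) {r : ℝ} (hr : 0 ≤ r) (z : ℂ) :
    shear s (r * z) = r * shear s z := by
  have : min (r * z.im) 0 = r * min z.im 0 := by
    rw [mul_min_of_nonneg _ _ hr, mul_zero]
  simp only [shear, Complex.im_ofReal_mul, this]
  push_cast
  ring

theorem shear_ne_zero (s : ℝ) {z : ℂ} (hz : z ≠ 0) : shear s z ≠ 0 := by
  intro h0
  apply hz
  rw [← shear_neg_shear s z, h0]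
  simp [shear]

theorem continuous_shear (s : ℝ) : Continuous (shear s) := by
  unfold shear
  fun_prop

/-- The self-map of the circle induced on directions by `shear s`. -/
noncomputable def shearMap (s : ℝ) (z : Circle) : Circle :=
  ⟨(‖shear s z‖⁻¹ : ℝ) * shear s z, by
    refine mem_sphere_zero_iff_norm.2 ?_
    rw [norm_mul, Complex.norm_real, norm_inv, norm_norm]
    exact inv_mul_cancel₀ (norm_ne_zero_iff.2 (shear_ne_zero s z.coe_ne_zero))⟩

theorem coe_shearMap (s : ℝ) (z : Circle) :
    (shearMap s z : ℂ) = (‖shear s z‖⁻¹ : ℝ) * shear s z := rfl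

theorem shearMap_neg_shearMap (s : ℝ) (z : Circle) : shearMap (-s) (shearMap s z) = z := by
  have hpos : 0 < ‖shear s z‖⁻¹ :=
    inv_pos.2 (norm_pos_iff.2 (shear_ne_zero s z.coe_ne_zero))
  ext
  rw [coe_shearMap, coe_shearMap, shear_real_mul _ hpos.le, shear_neg_shear, norm_mul,
    Complex.norm_real, norm_coe, mul_one, Real.norm_of_nonneg hpos.le, ← mul_assoc,
    ← Complex.ofReal_mul, inv_mul_cancel₀ hpos.ne', Complex.ofReal_one, one_mul]

theorem continuous_shearMap (s : ℝ) : Continuous (shearMap s) := by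
  have hc : Continuous fun z : Circle => shear s z :=
    (continuous_shear s).comp continuous_subtype_val
  refine Continuous.subtype_mk ((Complex.continuous_ofReal.comp (hc.norm.inv₀ fun z => ?_)).mul hc) _
  exact norm_ne_zero_iff.2 (shear_ne_zero s z.coe_ne_zero)

/-- `shearMap s` as a homeomorphism, with inverse `shearMap (-s)`. -/
noncomputable def shearHomeomorph (s : ℝ) : Circle ≃ₜ Circle where
  toFun := shearMap s
  invFun := shearMap (-s)
  left_inv := shearMap_neg_shearMap s
  right_inv z := by simpa using shearMap_neg_shearMap (-s) z
  continuous_toFun := continuous_shearMap s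
  continuous_invFun := continuous_shearMap (-s)

theorem shearMap_of_im_nonneg (s : ℝ) {z : Circle} (hz : 0 ≤ (z : ℂ).im) : shearMap s z = z := by
  have : shear s z = z := by simp [shear, min_eq_right hz]
  ext
  rw [coe_shearMap, this, norm_coe, inv_one, Complex.ofReal_one, one_mul]

theorem shearHomeomorph_ne_one {s : ℝ} (hs : s ≠ 0) : shearHomeomorph s ≠ 1 := by
  intro h1
  let w : Circle := ⟨-Complex.I, by simp [Submonoid.unitSphere]⟩
  have hw : shearMap s w = w := congrArg (fun e : Circle ≃ₜ Circle => e w) h1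
  have hre : (shearMap s w : ℂ).re = (w : ℂ).re := by rw [hw]
  rw [coe_shearMap, Complex.re_ofReal_mul] at hre
  have hne := norm_ne_zero_iff.2 (shear_ne_zero s w.coe_ne_zero)
  have hwre : (w : ℂ).re = 0 := by simp [w]
  have hsre : (shear s w).re = -s := by simp [shear, w]
  rw [hwre, hsre] at hre
  simp_all

/-- The positive part of the imaginary part, as a continuous function on the circle. -/
noncomputable def imPosPart : C(Circle, ℂ) where
  toFun z := (max (z : ℂ).im 0 : ℝ)
  continuous_toFun := by fun_prop

theorem imPosPart_ne_zero : imPosPart ≠ 0 := by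
  intro h0
  let w : Circle := ⟨Complex.I, by simp [Submonoid.unitSphere]⟩
  have hw : imPosPart w = 0 := by rw [h0]; rfl
  simp [imPosPart, w] at hw

theorem imPosPart_mul_shearMap (s : ℝ) (b : C(Circle, ℂ)) (z : Circle) :
    imPosPart z * b (shearMap s z) = imPosPart z * b z := by
  rcases le_total 0 (z : ℂ).im with hz | hz
  · rw [shearMap_of_im_nonneg s hz]
  · simp [imPosPart, max_eq_right hz]

end Circle

/-- **Example 6.9.** Let `X = S¹`, `G = Homeo(S¹)` acting naturally on `X`, and
`σ : G → Aut(C(X))` the induced homomorphism `σ g f x = f (g⁻¹ x)`. Then `C(X)` is not a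
maximal commutative subalgebra of the skew group algebra `C(X) ⋊_σ G`, and consequently
`C(X) ⋊_σ G` is not a simple ring. -/
theorem homeoCircle_skew_group_algebra_not_simple {R : Type*} [Ring R]
    (σ : (Circle ≃ₜ Circle) →* RingAut C(Circle, ℂ))
    (hσ : ∀ (g : Circle ≃ₜ Circle) (f : C(Circle, ℂ)) (x : Circle),
      σ g f x = f (g⁻¹ x))
    (ι : C(Circle, ℂ) →+* R) (u : (Circle ≃ₜ Circle) → R)
    (h : IsSkewGroupRing σ ι u) :
    Subring.centralizer (Set.range ι) ≠ ι.range ∧ ¬ IsSimpleRing R := by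
  have hne := Circle.shearHomeomorph_ne_one one_ne_zero
  have hfix : ∀ b, Circle.imPosPart * σ (Circle.shearHomeomorph 1) b = Circle.imPosPart * b := by
    intro b
    ext z
    rw [ContinuousMap.mul_apply, ContinuousMap.mul_apply, hσ]
    exact Circle.imPosPart_mul_shearMap (-1) b z
  exact ⟨h.centralizer_ne_range Circle.imPosPart_ne_zero hne hfix,
    h.not_isSimpleRing Circle.imPosPart_ne_zero hne hfix⟩
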